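/- If f(p) = D(a_0,...,a_n;p) is an optimal penalty function, then the nodes are strictly ordered: a_0 < a_1 < ... < a_n. -/

import Mathlib

open Finset

noncomputable def penalty (n : ℕ) (a : Fin (n+1) → ℝ) (p : ℝ) : ℝ :=
  ∑ k : Fin (n+1), (n.choose (k:ℕ) : ℝ) * p ^ (k:ℕ) * (1 - p) ^ (n - (k:ℕ)) * |p - a k|

def IsOptimal (n : ℕ) (a : Fin (n+1) → ℝ) : Prop :=
  (∀ k, a k ∈ Set.Icc (0:ℝ) 1) ∧
  ∀ b : Fin (n+1) → ℝ, (∀ k, b k ∈ Set.Icc (0:ℝ) 1) →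
    sSup ((fun p => penalty n a p) '' Set.Icc (0:ℝ) 1) ≤
      sSup ((fun p => penalty n b p) '' Set.Icc (0:ℝ) 1)

noncomputable def ww (n : ℕ) (k : ℕ) (p : ℝ) : ℝ := (n.choose k : ℝ) * p ^ k * (1 - p) ^ (n - k)

lemma penalty_eq (n : ℕ) (a : Fin (n+1) → ℝ) (p : ℝ) :
    penalty n a p = ∑ k : Fin (n+1), ww n k p * |p - a k| := rfl

lemma ww_nonneg (n k : ℕ) {p : ℝ} (hp : p ∈ Set.Icc (0:ℝ) 1) : 0 ≤ ww n k p := by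
  have h1 := hp.1
  have h2 : 0 ≤ 1 - p := by linarith [hp.2]
  unfold ww; positivity

lemma ww_pos (n : ℕ) (k : Fin (n+1)) {p : ℝ} (hp : p ∈ Set.Ioo (0:ℝ) 1) : 0 < ww n k p := by
  have h1 := hp.1
  have h2 : 0 < 1 - p := by linarith [hp.2]
  have h3 : 0 < n.choose k := Nat.choose_pos (by omega)
  unfold ww; positivity

lemma ww_diff (n k : ℕ) : Differentiable ℝ (ww n k) := by
  unfold ww; fun_prop

lemma penalty_cont (n : ℕ) (a : Fin (n+1) → ℝ) : Continuous (penalty n a) := by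
  unfold penalty; fun_prop

lemma penalty_cont_dir (n : ℕ) (a d : Fin (n+1) → ℝ) (p : ℝ) :
    Continuous (fun e : ℝ => penalty n (a + e • d) p) := by
  unfold penalty; simp only [Pi.add_apply, Pi.smul_apply, smul_eq_mul]; fun_prop

lemma penalty_conv (n : ℕ) (a d : Fin (n+1) → ℝ) {p t e : ℝ} (hp : p ∈ Set.Icc (0:ℝ) 1)
    (ht0 : 0 ≤ t) (ht1 : t ≤ 1) :
    penalty n (a + (t * e) • d) p ≤ (1 - t) * penalty n a p + t * penalty n (a + e • d) p := by
  simp only [penalty_eq, Finset.mul_sum, ← Finset.sum_add_distrib]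
  apply Finset.sum_le_sum
  intro k _
  have h := ww_nonneg n k hp
  have : |p - (a + (t * e) • d) k| ≤ (1 - t) * |p - a k| + t * |p - (a + e • d) k| := by
    have e1 : p - (a + (t * e) • d) k = (1 - t) * (p - a k) + t * (p - (a + e • d) k) := by
      simp; ring
    rw [e1]
    refine (abs_add_le _ _).trans ?_
    rw [abs_mul, abs_mul, abs_of_nonneg ht0, abs_of_nonneg (sub_nonneg.2 ht1)]
  nlinarith [mul_le_mul_of_nonneg_left this h]

lemma mono_dir (n : ℕ) (a d : Fin (n+1) → ℝ) {p e e' V : ℝ} (hp : p ∈ Set.Icc (0:ℝ) 1)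
    (h0 : penalty n a p ≤ V) (he : penalty n (a + e • d) p < V) (he' : 0 < e') (hee : e' ≤ e) :
    penalty n (a + e' • d) p < V := by
  have hep : 0 < e := by linarith
  have h := penalty_conv n a d (t := e' / e) (e := e) hp (by positivity) ((div_le_one hep).2 hee)
  rw [div_mul_cancel₀ _ hep.ne'] at h
  have ht : 0 < e' / e := by positivity
  have ht1 : e' / e ≤ 1 := (div_le_one hep).2 hee
  nlinarith

lemma compact_dir (n : ℕ) (a d : Fin (n+1) → ℝ) (V : ℝ) (K : Set ℝ) (hK : IsCompact K)
    (hK1 : K ⊆ Set.Icc 0 1) (h0 : ∀ p ∈ K, penalty n a p ≤ V)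
    (h : ∀ p ∈ K, ∃ e : ℝ, 0 < e ∧ penalty n (a + e • d) p < V) :
    ∃ e : ℝ, 0 < e ∧ ∀ p ∈ K, penalty n (a + e • d) p < V := by
  have := hK.induction_on (p := fun s => ∃ e : ℝ, 0 < e ∧ ∀ p ∈ s, p ∈ K → penalty n (a + e • d) p < V)
    ⟨1, one_pos, by simp⟩
    (fun s t hst ⟨e, he, h⟩ => ⟨e, he, fun p hp => h p (hst hp)⟩)
    (by
      rintro s t ⟨e, he, hs⟩ ⟨e', he', ht⟩
      refine ⟨min e e', lt_min he he', ?_⟩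
      rintro p (hp | hp) hpK
      · exact mono_dir n a d (hK1 hpK) (h0 p hpK) (hs p hp hpK) (lt_min he he') (min_le_left _ _)
      · exact mono_dir n a d (hK1 hpK) (h0 p hpK) (ht p hp hpK) (lt_min he he') (min_le_right _ _))
    (by
      intro p hp
      obtain ⟨e, he, hlt⟩ := h p hp
      refine ⟨{q | penalty n (a + e • d) q < V}, ?_, e, he, fun q hq _ => hq⟩
      exact mem_nhdsWithin_of_mem_nhds
        ((isOpen_lt (penalty_cont n _) continuous_const).mem_nhds hlt))
  obtain ⟨e, he, h⟩ := this
  exact ⟨e, he, fun p hp => h p hp hp⟩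

lemma small_dir (n : ℕ) (a d : Fin (n+1) → ℝ) (V p : ℝ) (h : penalty n a p < V) :
    ∃ e : ℝ, 0 < e ∧ penalty n (a + e • d) p < V := by
  have hc := (penalty_cont_dir n a d p).tendsto 0
  have h1 : ∀ᶠ e in nhds (0:ℝ), penalty n (a + e • d) p < V :=
    hc.eventually_lt_const (by simpa using h)
  have h2 : ∀ᶠ e in nhdsWithin (0:ℝ) (Set.Ioi 0), penalty n (a + e • d) p < V :=
    h1.filter_mono nhdsWithin_le_nhds
  obtain ⟨e, h3, h4⟩ := (h2.and self_mem_nhdsWithin).exists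
  exact ⟨e, h4, h3⟩

noncomputable def ss (p x : ℝ) : ℝ := if p < x then 1 else -1

noncomputable def LL (n : ℕ) (a d : Fin (n+1) → ℝ) (p : ℝ) : ℝ :=
  ∑ k : Fin (n+1), ww n k p * d k * ss p (a k)

lemma LL_dir (n : ℕ) (a d : Fin (n+1) → ℝ) (p : ℝ)
    (hs : ∀ k : Fin (n+1), a k ≠ p ∨ ww n k p = 0) (hL : LL n a d p < 0) :
    ∃ e : ℝ, 0 < e ∧ penalty n (a + e • d) p < penalty n a p := by
  have h1 : ∀ᶠ e in nhdsWithin (0:ℝ) (Set.Ioi 0), ∀ k : Fin (n+1),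
      ww n k p * |p - (a + e • d) k| = ww n k p * |p - a k| + e * (ww n k p * d k * ss p (a k)) := by
    rw [Filter.eventually_all]
    intro k
    rcases hs k with h | h
    · have hc : Continuous (fun e : ℝ => a k + e * d k) := by fun_prop
      have hc0 := hc.tendsto 0
      apply Filter.Eventually.filter_mono nhdsWithin_le_nhds
      rcases lt_or_gt_of_ne h with h | h
      · filter_upwards [hc0.eventually_lt_const (u := p) (by simpa using h)] with e he
        simp only [Pi.add_apply, Pi.smul_apply, smul_eq_mul]
        rw [abs_of_pos (by linarith), abs_of_pos (by linarith), ss, if_neg (by linarith)]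
        ring
      · filter_upwards [hc0.eventually_const_lt (u := p) (by simpa using h)] with e he
        simp only [Pi.add_apply, Pi.smul_apply, smul_eq_mul]
        rw [abs_of_neg (by linarith), abs_of_neg (by linarith), ss, if_pos (by linarith)]
        ring
    · simp [h]
  obtain ⟨e, h3, h4⟩ := (h1.and self_mem_nhdsWithin).exists
  refine ⟨e, h4, ?_⟩
  have : penalty n (a + e • d) p = penalty n a p + e * LL n a d p := by
    rw [penalty_eq, penalty_eq, LL, Finset.mul_sum, ← Finset.sum_add_distrib]
    exact Finset.sum_congr rfl fun k _ => h3 k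
  have h5 : (0:ℝ) < e := h4
  nlinarith

lemma kink (n : ℕ) (a : Fin (n+1) → ℝ) (p : ℝ) (hp : p ∈ Set.Ioo (0:ℝ) 1)
    (hmax : ∀ q ∈ Set.Icc (0:ℝ) 1, penalty n a q ≤ penalty n a p) (k : Fin (n+1)) : a k ≠ p := by
  intro hk
  let T : ℝ → ℝ := fun q => ∑ i ∈ Finset.univ.erase k, ww n i q * ((q - a i) * (- ss p (a i)))
  have hT : DifferentiableAt ℝ T p := by
    have := fun i => ww_diff n i
    fun_prop
  have hsp : ∀ x y : ℝ, y * (- ss p x) ≤ |y| := by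
    intro x y; unfold ss
    split_ifs
    · linarith [neg_abs_le y]
    · linarith [le_abs_self y]
  have hTp : T p = penalty n a p := by
    rw [penalty_eq, ← Finset.add_sum_erase _ _ (Finset.mem_univ k), hk]
    simp only [sub_self, abs_zero, mul_zero, zero_add]
    refine Finset.sum_congr rfl fun i _ => ?_
    congr 1
    unfold ss
    split_ifs with h
    · rw [abs_of_neg (by linarith)]; ring
    · rw [abs_of_nonneg (by linarith)]; ring
  have key : ∀ s : ℝ, (s = 1 ∨ s = -1) → deriv T p + s * ww n k p = 0 := by
    intro s hs
    have hd : HasDerivAt (fun q => T q + s * (ww n k q * (q - p)))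
        (deriv T p + s * ww n k p) p := by
      have h1 := (ww_diff n k p).hasDerivAt.mul ((hasDerivAt_id p).sub_const p)
      have h2 := hT.hasDerivAt.add (h1.const_mul s)
      refine HasDerivAt.congr_deriv h2 ?_
      simp
    refine IsLocalMax.hasDerivAt_eq_zero ?_ hd
    filter_upwards [Ioo_mem_nhds hp.1 hp.2] with q hq
    have hq' := Set.Ioo_subset_Icc_self hq
    refine le_trans ?_ ((hmax q hq').trans ?_)
    · rw [penalty_eq, ← Finset.add_sum_erase _ _ (Finset.mem_univ k), hk, add_comm]
      apply add_le_add
      · have : s * (q - p) ≤ |q - p| := by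
          rcases hs with rfl | rfl
          · linarith [le_abs_self (q - p)]
          · linarith [neg_abs_le (q - p)]
        nlinarith [mul_le_mul_of_nonneg_left this (ww_nonneg n k hq')]
      · exact Finset.sum_le_sum fun i _ =>
          mul_le_mul_of_nonneg_left (hsp _ _) (ww_nonneg n i hq')
    · rw [← hTp]; simp
  have h1 := key 1 (Or.inl rfl)
  have h2 := key (-1) (Or.inr rfl)
  have := ww_pos n k hp
  linarith

lemma ww_zero (n k : ℕ) (hk : k ≠ 0) : ww n k 0 = 0 := by simp [ww, hk]

lemma ww_one (n : ℕ) (k : ℕ) (hk : k < n) : ww n k 1 = 0 := by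
  have : n - k ≠ 0 := by omega
  simp [ww, this]

lemma penalty_zero (n : ℕ) (a : Fin (n+1) → ℝ) : penalty n a 0 = |a 0| := by
  rw [penalty_eq, Finset.sum_eq_single 0]
  · simp [ww]
  · intro k _ hk
    rw [ww_zero _ _ (fun h0 => hk (Fin.ext h0)), zero_mul]
  · simp

lemma penalty_one (n : ℕ) (a : Fin (n+1) → ℝ) : penalty n a 1 = |1 - a (Fin.last n)| := by
  rw [penalty_eq, Finset.sum_eq_single (Fin.last n)]
  · simp [ww]
  · intro k _ hk
    rw [ww_one n k (Fin.lt_last_iff_ne_last.2 hk), zero_mul]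
  · simp

lemma LL_two (n : ℕ) (a : Fin (n+1) → ℝ) (p x y : ℝ) (j k : Fin (n+1)) :
    LL n a (Pi.single j x + Pi.single k y) p
      = ww n j p * x * ss p (a j) + ww n k p * y * ss p (a k) := by
  simp only [LL, Pi.add_apply, mul_add, add_mul, Finset.sum_add_distrib]
  congr 1
  · rw [Finset.sum_eq_single j]
    · simp
    · intro i _ hi; simp [hi]
    · simp
  · rw [Finset.sum_eq_single k]
    · simp
    · intro i _ hi; simp [hi]
    · simp

lemma LL_lin (n : ℕ) (a d d' : Fin (n+1) → ℝ) (p x y : ℝ) :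
    LL n a (x • d + y • d') p = x * LL n a d p + y * LL n a d' p := by
  simp only [LL, Finset.mul_sum, ← Finset.sum_add_distrib]
  refine Finset.sum_congr rfl fun k _ => ?_
  simp; ring

lemma LL_d1 (n : ℕ) (a : Fin (n+1) → ℝ) (j : Fin n) (p : ℝ) :
    LL n a (Pi.single j.castSucc (-(a j.castSucc / n.choose j)) +
      Pi.single j.succ ((1 - a j.castSucc) / n.choose (j+1))) p
    = p ^ (j:ℕ) * (1 - p) ^ (n - (j+1)) * (-(a j.castSucc) * (1 - p) * ss p (a j.castSucc)
      + (1 - a j.castSucc) * p * ss p (a j.succ)) := by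
  rw [LL_two]
  have h1 : (n.choose j : ℝ) ≠ 0 := by
    exact_mod_cast (Nat.choose_pos (by omega)).ne'
  have h2 : (n.choose (j+1) : ℝ) ≠ 0 := by
    exact_mod_cast (Nat.choose_pos (by omega)).ne'
  have h3 : n - (j:ℕ) = (n - (j+1)) + 1 := by omega
  simp only [ww, Fin.val_castSucc, Fin.val_succ]
  rw [h3, pow_succ, pow_succ]
  field_simp

lemma d1_nonpos (n : ℕ) (a : Fin (n+1) → ℝ) (ha : ∀ k, a k ∈ Set.Icc (0:ℝ) 1) (j : Fin n)
    (hj : a j.succ ≤ a j.castSucc) (p : ℝ) (hp : p ∈ Set.Icc (0:ℝ) 1) :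
    (-(a j.castSucc) * (1 - p) * ss p (a j.castSucc)
      + (1 - a j.castSucc) * p * ss p (a j.succ)) ≤ 0 := by
  obtain ⟨h1, h2⟩ := ha j.castSucc
  obtain ⟨h3, h4⟩ := hp
  unfold ss
  split_ifs
  · linarith
  · nlinarith [mul_nonneg h1 (sub_nonneg.2 h4), mul_nonneg (sub_nonneg.2 h2) h3]
  · exfalso; linarith
  · linarith

lemma d1_neg (n : ℕ) (a : Fin (n+1) → ℝ) (ha : ∀ k, a k ∈ Set.Icc (0:ℝ) 1) (j : Fin n)
    (hj : a j.succ ≤ a j.castSucc) (p : ℝ) (hp : p ∈ Set.Ioo (0:ℝ) 1) (hne : a j.castSucc ≠ p) :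
    (-(a j.castSucc) * (1 - p) * ss p (a j.castSucc)
      + (1 - a j.castSucc) * p * ss p (a j.succ)) < 0 := by
  obtain ⟨h1, h2⟩ := ha j.castSucc
  obtain ⟨h3, h4⟩ := hp
  unfold ss
  split_ifs with h5 h6 h7
  · linarith
  · have : 0 < a j.castSucc * (1 - p) := mul_pos (by linarith) (by linarith)
    nlinarith [mul_nonneg (sub_nonneg.2 h2) h3.le]
  · exfalso; linarith
  · have := lt_of_le_of_ne (not_lt.1 h5) hne
    linarith

lemma ss_le (p x : ℝ) : ss p x ≤ 1 := by unfold ss; split_ifs <;> norm_num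
lemma le_ss (p x : ℝ) : -1 ≤ ss p x := by unfold ss; split_ifs <;> norm_num

lemma d2_neg (n : ℕ) (hn : 0 < n) (a : Fin (n+1) → ℝ) (p : ℝ) (hp : p ∈ Set.Icc (0:ℝ) 1)
    (h : (p < a 0 ∧ p < 1/2) ∨ (a (Fin.last n) < p ∧ 1/2 < p)) :
    LL n a (Pi.single 0 (-1) + Pi.single (Fin.last n) 1) p < 0 := by
  rw [LL_two]
  have e1 : ww n ((0 : Fin (n+1)) : ℕ) p = (1 - p) ^ n := by simp [ww]
  have e2 : ww n (Fin.last n : ℕ) p = p ^ n := by simp [ww]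
  rw [e1, e2]
  have p1 : 0 ≤ p ^ n := pow_nonneg hp.1 n
  have p2 : 0 ≤ (1 - p) ^ n := pow_nonneg (by linarith [hp.2]) n
  rcases h with ⟨h, h'⟩ | ⟨h, h'⟩
  · have : p ^ n < (1 - p) ^ n := pow_lt_pow_left₀ (by linarith) hp.1 hn.ne'
    have e : ss p (a 0) = 1 := if_pos h
    rw [e]
    nlinarith [mul_le_mul_of_nonneg_left (ss_le p (a (Fin.last n))) p1]
  · have : (1 - p) ^ n < p ^ n := pow_lt_pow_left₀ (by linarith) (by linarith [hp.2]) hn.ne'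
    have e : ss p (a (Fin.last n)) = -1 := if_neg (by linarith)
    rw [e]
    nlinarith [mul_le_mul_of_nonneg_left (le_ss p (a 0)) p2]

theorem stmt_6 (n : ℕ) (hn : 0 < n) (a : Fin (n+1) → ℝ) (ha : IsOptimal n a) :
    StrictMono a := by
  obtain ⟨ha, hopt⟩ := ha
  rw [Fin.strictMono_iff_lt_succ]
  intro j
  by_contra hj
  rw [not_lt] at hj
  obtain ⟨p0, hp0, hmax⟩ := (isCompact_Icc (a := (0:ℝ)) (b := 1)).exists_isMaxOn
    ⟨0, by simp⟩ (penalty_cont n a).continuousOn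
  replace hmax : ∀ q ∈ Set.Icc (0:ℝ) 1, penalty n a q ≤ penalty n a p0 := fun q hq => hmax hq
  set V := penalty n a p0 with hV
  have hVpos : 0 < V := by
    have : ∃ q ∈ Set.Ioo (0:ℝ) 1, q ≠ a 0 := by
      by_cases h : a 0 = 1/2
      · exact ⟨1/3, by norm_num, by rw [h]; norm_num⟩
      · exact ⟨1/2, by norm_num, fun h' => h h'.symm⟩
    obtain ⟨q, hq, hq0⟩ := this
    have hq' := Set.Ioo_subset_Icc_self hq
    refine lt_of_lt_of_le ?_ (hmax q hq')
    rw [penalty_eq]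
    refine Finset.sum_pos' (fun i _ => mul_nonneg (ww_nonneg n i hq') (abs_nonneg _))
      ⟨0, Finset.mem_univ _, mul_pos (ww_pos n 0 hq) (abs_pos.2 (sub_ne_zero.2 hq0))⟩
  -- endpoint facts
  have hz : penalty n a 0 = V → 0 < a 0 := by
    intro h; rw [penalty_zero, abs_of_nonneg (ha 0).1] at h; linarith
  have ho : penalty n a 1 = V → a (Fin.last n) < 1 := by
    intro h; rw [penalty_one, abs_of_nonneg (by linarith [(ha (Fin.last n)).2])] at h; linarith
  have hint : ∀ p ∈ Set.Ioo (0:ℝ) 1, penalty n a p = V → ∀ k, a k ≠ p := fun p hp h k =>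
    kink n a p hp (by rw [h]; exact hmax) k
  have hgood : ∀ p ∈ Set.Icc (0:ℝ) 1, penalty n a p = V →
      ∀ k : Fin (n+1), a k ≠ p ∨ ww n k p = 0 := by
    intro p hp h k
    rcases hp.1.eq_or_lt with rfl | h0
    · by_cases hk : k = 0
      · subst hk; left; exact (hz h).ne'
      · right; exact ww_zero _ _ (fun h0 => hk (Fin.ext h0))
    rcases hp.2.eq_or_lt with rfl | h1
    · by_cases hk : k = Fin.last n
      · subst hk; left; exact (ho h).ne
      · right; exact ww_one n k (Fin.lt_last_iff_ne_last.2 hk)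
    · exact Or.inl (hint p ⟨h0, h1⟩ h k)
  set d1 : Fin (n+1) → ℝ := Pi.single j.castSucc (-(a j.castSucc / n.choose j)) +
      Pi.single j.succ ((1 - a j.castSucc) / n.choose (j+1)) with hd1
  set d2 : Fin (n+1) → ℝ := Pi.single 0 (-1) + Pi.single (Fin.last n) 1 with hd2
  let U : Set ℝ := {p | (p < a 0 ∧ p < 1/2) ∨ (a (Fin.last n) < p ∧ 1/2 < p)}
  have hU : IsOpen U := by
    have : U = (Set.Iio (a 0) ∩ Set.Iio (1/2)) ∪ (Set.Ioi (a (Fin.last n)) ∩ Set.Ioi (1/2)) := rfl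
    rw [this]
    exact (isOpen_Iio.inter isOpen_Iio).union (isOpen_Ioi.inter isOpen_Ioi)
  let N : Set ℝ := (Set.Icc (0:ℝ) 1 ∩ {p | penalty n a p = V}) \ U
  have hN : IsCompact N :=
    (isCompact_Icc.inter_right (isClosed_eq (penalty_cont n a) continuous_const)).diff hU
  have hNI : N ⊆ Set.Icc 0 1 := fun p hp => hp.1.1
  have hNo : ∀ p ∈ N, p ∈ Set.Ioo (0:ℝ) 1 := by
    rintro p ⟨⟨hp, h⟩, hpU⟩
    refine ⟨lt_of_le_of_ne hp.1 ?_, lt_of_le_of_ne hp.2 ?_⟩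
    · rintro rfl; exact hpU (Or.inl ⟨hz h, by norm_num⟩)
    · rintro rfl; exact hpU (Or.inr ⟨ho h, by norm_num⟩)
  have hL1 : ∀ p ∈ Set.Icc (0:ℝ) 1, LL n a d1 p ≤ 0 := by
    intro p hp
    rw [hd1, LL_d1]
    have h1 := pow_nonneg hp.1 (j:ℕ)
    have h2 := pow_nonneg (sub_nonneg.2 hp.2) (n - (j+1))
    exact mul_nonpos_of_nonneg_of_nonpos (mul_nonneg h1 h2) (d1_nonpos n a ha j hj p hp)
  have hL1' : ∀ p ∈ N, LL n a d1 p < 0 := by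
    intro p hp
    have hpo := hNo p hp
    rw [hd1, LL_d1]
    have h1 := pow_pos hpo.1 (j:ℕ)
    have h2 := pow_pos (sub_pos.2 hpo.2) (n - (j+1))
    exact mul_neg_of_pos_of_neg (mul_pos h1 h2)
      (d1_neg n a ha j hj p hpo (hint p hpo hp.1.2 _))
  obtain ⟨e1, he1, hE1⟩ := compact_dir n a d1 V N hN hNI (fun p hp => hmax p (hNI hp)) (by
    intro p hp
    obtain ⟨e, he, h⟩ := LL_dir n a d1 p (hgood p (hNI hp) hp.1.2) (hL1' p hp)
    exact ⟨e, he, h.trans_eq hp.1.2⟩)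
  obtain ⟨e2, he2, hE2⟩ := compact_dir n (a + e1 • d1) d2 V N hN hNI (fun p hp => (hE1 p hp).le)
    (fun p hp => small_dir n _ d2 V p (hE1 p hp))
  obtain ⟨e, he, hE⟩ := compact_dir n a (e1 • d1 + e2 • d2) V (Set.Icc 0 1) isCompact_Icc
    subset_rfl hmax (by
    intro p hp
    rcases (hmax p hp).lt_or_eq with hlt | heq
    · exact small_dir n a _ V p hlt
    by_cases hpU : p ∈ U
    · obtain ⟨e, he, h⟩ := LL_dir n a (e1 • d1 + e2 • d2) p (hgood p hp heq) (by
        rw [LL_lin]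
        have h1 := hL1 p hp
        have h2 := d2_neg n hn a p hp hpU
        have h3 := mul_nonpos_of_nonneg_of_nonpos he1.le h1
        have h4 := mul_neg_of_pos_of_neg he2 h2
        linarith)
      exact ⟨e, he, h.trans_eq heq⟩
    · refine ⟨1, one_pos, ?_⟩
      rw [one_smul, ← add_assoc]
      exact hE2 p ⟨⟨hp, heq⟩, hpU⟩)
  -- clip
  let b : Fin (n+1) → ℝ := a + e • (e1 • d1 + e2 • d2)
  let c : Fin (n+1) → ℝ := fun k => max 0 (min 1 (b k))
  have hc : ∀ k, c k ∈ Set.Icc (0:ℝ) 1 := fun k =>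
    ⟨le_max_left _ _, max_le zero_le_one (min_le_left _ _)⟩
  have hcb : ∀ p ∈ Set.Icc (0:ℝ) 1, penalty n c p < V := by
    intro p hp
    refine lt_of_le_of_lt ?_ (hE p hp)
    refine Finset.sum_le_sum fun k _ => mul_le_mul_of_nonneg_left ?_ (ww_nonneg n k hp)
    change |p - max 0 (min 1 (b k))| ≤ |p - b k|
    obtain ⟨h0, h1⟩ := hp
    rcases le_total (b k) 0 with h | h
    · rw [min_eq_right (by linarith), max_eq_left h, abs_of_nonneg (by linarith),
        abs_of_nonneg (by linarith)]
      linarith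
    rcases le_total (b k) 1 with h' | h'
    · rw [min_eq_right h', max_eq_right h]
    · rw [min_eq_left h', max_eq_right zero_le_one, abs_of_nonpos (by linarith),
        abs_of_nonpos (by linarith)]
      linarith
  obtain ⟨p1, hp1, hmax1⟩ := (isCompact_Icc (a := (0:ℝ)) (b := 1)).exists_isMaxOn
    ⟨0, by simp⟩ (penalty_cont n c).continuousOn
  have h1 : sSup ((fun p => penalty n c p) '' Set.Icc (0:ℝ) 1) ≤ penalty n c p1 := by
    apply csSup_le (Set.Nonempty.image _ ⟨0, by simp⟩)
    rintro _ ⟨q, hq, rfl⟩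
    exact hmax1 hq
  have h2 : V ≤ sSup ((fun p => penalty n a p) '' Set.Icc (0:ℝ) 1) := by
    apply le_csSup
    · refine ⟨V, ?_⟩
      rintro _ ⟨q, hq, rfl⟩
      exact hmax q hq
    · exact ⟨p0, hp0, rfl⟩
  have h3 := hopt c hc
  have h4 := hcb p1 hp1
  linarith
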